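/- For every time warp f, last (f⋆) = ⊤ if, and only if, last f = ⊤. -/

import Mathlib

/-- A map `f : ℕ∞ → ℕ∞` preserves arbitrary suprema. -/
def PreservesSSup (f : ℕ∞ → ℕ∞) : Prop :=
  ∀ S : Set ℕ∞, f (sSup S) = sSup (f '' S)

/-- The predecessor time warp: `pred 0 = 0`, `pred ⊤ = ⊤`, `pred (n+1) = n`. -/
def wpred (m : ℕ∞) : ℕ∞ := if m = ⊤ then ⊤ else ((m.toNat - 1 : ℕ) : ℕ∞)

/-- The involution `f⋆` of a time warp `f`: `f⋆ m = ⨅ {pred n | n ∈ ℕ∞, m ≤ f n}`. -/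
noncomputable def winv (f : ℕ∞ → ℕ∞) : ℕ∞ → ℕ∞ :=
  fun m => sInf {y | ∃ n : ℕ∞, m ≤ f n ∧ y = wpred n}

/-- `last f = sInf {m | f m = f ⊤}`. -/
noncomputable def wlast (f : ℕ∞ → ℕ∞) : ℕ∞ := sInf {m | f m = f ⊤}

theorem PreservesSSup.map_zero {f : ℕ∞ → ℕ∞} (hf : PreservesSSup f) : f 0 = 0 := by
  simpa using hf ∅

theorem PreservesSSup.monotone {f : ℕ∞ → ℕ∞} (hf : PreservesSSup f) : Monotone f := by
  intro a b hab
  have h := hf {a, b}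
  rw [sSup_pair, sup_eq_right.2 hab] at h
  rw [h]
  exact le_sSup ⟨a, by simp, rfl⟩

/-- A finite value below `f ⊤` is already reached by `f` at a finite argument. -/
theorem PreservesSSup.exists_natCast_le {f : ℕ∞ → ℕ∞} (hf : PreservesSSup f) (m : ℕ)
    (hm : (m : ℕ∞) ≤ f ⊤) : ∃ n : ℕ, (m : ℕ∞) ≤ f n := by
  cases m with
  | zero => exact ⟨0, by simp⟩
  | succ c =>
    have hlt : (c : ℕ∞) < f ⊤ := lt_of_lt_of_le (by exact_mod_cast Nat.lt_succ_self c) hm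
    have htop : sSup (Set.range ((↑) : ℕ → ℕ∞)) = ⊤ := ENat.iSup_natCast
    rw [← htop, hf, lt_sSup_iff] at hlt
    obtain ⟨_, ⟨_, ⟨n, rfl⟩, rfl⟩, hn⟩ := hlt
    exact ⟨n, by simpa using Order.add_one_le_of_lt hn⟩

theorem wpred_natCast_ne_top (n : ℕ) : wpred n ≠ ⊤ := by
  simp [wpred]

theorem wlast_eq_top_iff (f : ℕ∞ → ℕ∞) : wlast f = ⊤ ↔ ∀ m, f m = f ⊤ → m = ⊤ := by
  simp [wlast, sInf_eq_top]

theorem winv_natCast_ne_top {f : ℕ∞ → ℕ∞} (hf : PreservesSSup f) (htop : f ⊤ = ⊤) (m : ℕ) :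
    winv f m ≠ ⊤ := by
  obtain ⟨n, hn⟩ := hf.exists_natCast_le m (by simp [htop])
  exact ne_top_of_le_ne_top (wpred_natCast_ne_top n) (sInf_le ⟨n, hn, rfl⟩)

theorem PreservesSSup.map_top_of_wlast_eq_top {f : ℕ∞ → ℕ∞} (hf : PreservesSSup f)
    (h : wlast f = ⊤) : f ⊤ = ⊤ := by
  by_contra hne
  obtain ⟨c, hc⟩ := ENat.ne_top_iff_exists.1 hne
  obtain ⟨n, hn⟩ := hf.exists_natCast_le c hc.le
  have := (wlast_eq_top_iff f).1 h n (le_antisymm (hf.monotone le_top) (hc ▸ hn))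
  exact ENat.natCast_ne_top n this

theorem winv_top_of_wlast_eq_top {f : ℕ∞ → ℕ∞} (hf : PreservesSSup f)
    (h : wlast f = ⊤) : winv f ⊤ = ⊤ := by
  refine sInf_eq_top.2 ?_
  rintro _ ⟨n, hn, rfl⟩
  have : n = ⊤ := (wlast_eq_top_iff f).1 h n (le_antisymm (hf.monotone le_top) (le_top.trans hn))
  simp [this, wpred]

/-- If `f` is eventually constant, then beyond some finite value `f` only takes the value `⊤`. -/
theorem exists_natCast_forall_le_imp_eq_top {f : ℕ∞ → ℕ∞} (hf : PreservesSSup f)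
    (h : wlast f ≠ ⊤) : ∃ c : ℕ, ∀ n, (c : ℕ∞) ≤ f n → f n = ⊤ := by
  by_cases htop : f ⊤ = ⊤
  · have hex : ∃ k : ℕ, f k = ⊤ := by
      rw [Ne, wlast_eq_top_iff] at h
      push Not at h
      obtain ⟨m, hm, hne⟩ := h
      obtain ⟨k, rfl⟩ := ENat.ne_top_iff_exists.1 hne
      exact ⟨k, hm.trans htop⟩
    classical
    obtain ⟨k, hk, hmin⟩ : ∃ k : ℕ, f k = ⊤ ∧ ∀ j < k, f (j : ℕ) ≠ ⊤ :=
      ⟨Nat.find hex, Nat.find_spec hex, fun j hj => Nat.find_min hex hj⟩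
    cases k with
    | zero => simp [hf.map_zero] at hk
    | succ j =>
      obtain ⟨c, hc⟩ := ENat.ne_top_iff_exists.1 (hmin j (Nat.lt_succ_self j))
      refine ⟨c + 1, fun n hn => ?_⟩
      have hjn : (j : ℕ∞) < n := by
        by_contra hle
        have h2 : ((c + 1 : ℕ) : ℕ∞) ≤ c := hn.trans (hc ▸ hf.monotone (not_lt.1 hle))
        exact absurd (Nat.cast_le.1 h2) (by omega)
      have hle : ((j + 1 : ℕ) : ℕ∞) ≤ n := by simpa using Order.add_one_le_of_lt hjn
      exact top_le_iff.1 (hk ▸ hf.monotone hle)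
  · obtain ⟨c, hc⟩ := ENat.ne_top_iff_exists.1 htop
    refine ⟨c + 1, fun n hn => ?_⟩
    have h2 : ((c + 1 : ℕ) : ℕ∞) ≤ c := hn.trans (hc ▸ hf.monotone le_top)
    exact absurd (Nat.cast_le.1 h2) (by omega)

theorem stmt9 (f : ℕ∞ → ℕ∞) (hf : PreservesSSup f) :
    wlast (winv f) = ⊤ ↔ wlast f = ⊤ := by
  constructor
  · intro h
    by_contra hne
    obtain ⟨c, hc⟩ := exists_natCast_forall_le_imp_eq_top hf hne
    refine ENat.natCast_ne_top c ((wlast_eq_top_iff _).1 h c ?_)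
    have hiff (n : ℕ∞) : (c : ℕ∞) ≤ f n ↔ ⊤ ≤ f n :=
      ⟨fun hn => (hc n hn).ge, fun hn => le_top.trans hn⟩
    simp only [winv, hiff]
  · intro h
    refine (wlast_eq_top_iff _).2 fun m hm => ?_
    by_contra hne
    obtain ⟨k, rfl⟩ := ENat.ne_top_iff_exists.1 hne
    exact winv_natCast_ne_top hf (hf.map_top_of_wlast_eq_top h) k
      (hm.trans (winv_top_of_wlast_eq_top hf h))
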